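/- arXiv:2108.09844 — 2 statements merged into one kernel-verified Lean document; each statement's English description precedes it below -/
import Mathlib

section
/- Assume t > λ₁(μ)². Let w(0) be the unique s > 0 with ∫ 1/(s² + u²) dμ(u) = 1/t, and for ε > 0 let w(ε) be the unique s ∈ (ε,∞) with h_μ(s) = (s − ε)/t. Then there exist δ > 0 and a real-analytic function W : (−δ,δ) → ℝ such that W(0) = w(0), W(ε) = w(ε) for all 0 < ε < δ, and W′(0) > 0. -/
open MeasureTheory

lemma aux_norm (z : ℂ) (u r : ℝ) (hr : 0 < r) (hz : r ≤ z.re) :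
    r ^ 2 ≤ ‖z ^ 2 + (u : ℂ) ^ 2‖ := by
  have h1 : (r ^ 2) ^ 2 ≤ ‖z ^ 2 + (u : ℂ) ^ 2‖ ^ 2 := by
    rw [← Complex.normSq_eq_norm_sq, Complex.normSq_apply]
    have h4 : r ^ 4 ≤ z.re ^ 4 := by gcongr
    simp [pow_two]
    nlinarith [sq_nonneg (z.re * u), sq_nonneg (z.re * z.im), sq_nonneg (u ^ 2 - z.im ^ 2)]
  exact (pow_le_pow_iff_left₀ (by positivity) (norm_nonneg _) two_ne_zero).1 h1

lemma aux_deriv (μ : Measure ℝ) [IsProbabilityMeasure μ] (z : ℂ) (hz : 0 < z.re) :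
    HasDerivAt (fun z : ℂ => ∫ u : ℝ, (z ^ 2 + (u : ℂ) ^ 2)⁻¹ ∂μ)
      (∫ u : ℝ, -(2 * z) / (z ^ 2 + (u : ℂ) ^ 2) ^ 2 ∂μ) z := by
  set r := z.re / 2 with hr
  have hr0 : 0 < r := by positivity
  have hre : ∀ x ∈ Metric.ball z r, r ≤ x.re := by
    intro x hx
    have h1 : |(x - z).re| ≤ ‖x - z‖ := Complex.abs_re_le_norm _
    rw [Metric.mem_ball, dist_eq_norm] at hx
    have := (abs_le.1 h1).1
    simp at this
    linarith
  have hn : ∀ x ∈ Metric.ball z r, ∀ u : ℝ, r ^ 2 ≤ ‖x ^ 2 + (u : ℂ) ^ 2‖ :=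
    fun x hx u => aux_norm x u r hr0 (hre x hx)
  have hne : ∀ x ∈ Metric.ball z r, ∀ u : ℝ, x ^ 2 + (u : ℂ) ^ 2 ≠ 0 := by
    intro x hx u
    have := hn x hx u
    rw [← norm_pos_iff]
    exact lt_of_lt_of_le (by positivity) this
  have hm : ∀ x : ℂ, AEStronglyMeasurable (fun u : ℝ => (x ^ 2 + (u : ℂ) ^ 2)⁻¹) μ := by
    intro x
    exact Measurable.aestronglyMeasurable (by fun_prop)
  refine (hasDerivAt_integral_of_dominated_loc_of_deriv_le
    (F := fun (z : ℂ) (u : ℝ) => (z ^ 2 + (u : ℂ) ^ 2)⁻¹)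
    (F' := fun (z : ℂ) (u : ℝ) => -(2 * z) / (z ^ 2 + (u : ℂ) ^ 2) ^ 2)
    (bound := fun _ => 2 * (‖z‖ + r) / (r ^ 2) ^ 2)
    (Metric.ball_mem_nhds z hr0) (Filter.Eventually.of_forall hm) ?_ ?_ ?_ ?_ ?_).2
  · refine Integrable.of_bound (hm z) ((r ^ 2)⁻¹) (Filter.Eventually.of_forall fun u => ?_)
    rw [norm_inv]
    exact inv_anti₀ (by positivity) (hn z (Metric.mem_ball_self hr0) u)
  · exact Measurable.aestronglyMeasurable (by fun_prop)
  · refine Filter.Eventually.of_forall fun u x hx => ?_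
    rw [norm_div, norm_neg, norm_mul, norm_pow]
    have h1 : ‖x‖ ≤ ‖z‖ + r := by
      have h2 : ‖x‖ ≤ ‖z‖ + ‖x - z‖ := by
        simpa using norm_add_le z (x - z)
      rw [Metric.mem_ball, dist_eq_norm] at hx
      linarith
    have := hn x hx u
    have h2 : ‖(2 : ℂ)‖ = 2 := by simp
    rw [h2]
    gcongr
  · exact integrable_const _
  · refine Filter.Eventually.of_forall fun u x hx => ?_
    have h1 : HasDerivAt (fun x : ℂ => x ^ 2 + (u : ℂ) ^ 2) (2 * x) x := by
      simpa using (hasDerivAt_pow 2 x).add_const ((u : ℂ) ^ 2)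
    exact h1.fun_inv (hne x hx u)

lemma aux_real_eq (μ : Measure ℝ) (s : ℝ) :
    (∫ u : ℝ, (s ^ 2 + u ^ 2)⁻¹ ∂μ) = (∫ u : ℝ, ((s : ℂ) ^ 2 + (u : ℂ) ^ 2)⁻¹ ∂μ).re := by
  have : (∫ u : ℝ, ((s : ℂ) ^ 2 + (u : ℂ) ^ 2)⁻¹ ∂μ)
      = ∫ u : ℝ, (((s ^ 2 + u ^ 2)⁻¹ : ℝ) : ℂ) ∂μ := by
    congr 1; ext u; push_cast; rfl
  rw [this, integral_complex_ofReal, Complex.ofReal_re]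

lemma aux_analytic (μ : Measure ℝ) [IsProbabilityMeasure μ] (s : ℝ) (hs : 0 < s) :
    AnalyticAt ℝ (fun s : ℝ => ∫ u : ℝ, (s ^ 2 + u ^ 2)⁻¹ ∂μ) s := by
  have hA : AnalyticAt ℂ (fun z : ℂ => ∫ u : ℝ, (z ^ 2 + (u : ℂ) ^ 2)⁻¹ ∂μ) (s : ℂ) := by
    have ho : IsOpen {z : ℂ | 0 < z.re} := isOpen_lt continuous_const Complex.continuous_re
    refine DifferentiableOn.analyticAt (s := {z : ℂ | 0 < z.re}) (fun z hz =>
      (aux_deriv μ z hz).differentiableAt.differentiableWithinAt) (ho.mem_nhds (by simpa using hs))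
  have hB : AnalyticAt ℝ (fun s : ℝ => (∫ u : ℝ, ((s : ℂ) ^ 2 + (u : ℂ) ^ 2)⁻¹ ∂μ)) s :=
    (hA.restrictScalars (𝕜 := ℝ)).comp' (Complex.ofRealCLM.analyticAt s)
  have hC := (Complex.reCLM.analyticAt _).comp' hB
  exact hC.congr (Filter.Eventually.of_forall fun x => (aux_real_eq μ x).symm)

lemma aux_real_deriv (μ : Measure ℝ) [IsProbabilityMeasure μ] (s : ℝ) (hs : 0 < s) :
    ∃ d < 0, HasDerivAt (fun s : ℝ => ∫ u : ℝ, (s ^ 2 + u ^ 2)⁻¹ ∂μ) d s := by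
  have h1 := (aux_deriv μ (s : ℂ) (by simpa using hs)).real_of_complex
  have h2 : (∫ u : ℝ, -(2 * (s : ℂ)) / ((s : ℂ) ^ 2 + (u : ℂ) ^ 2) ^ 2 ∂μ)
      = ∫ u : ℝ, ((-(2 * s / (s ^ 2 + u ^ 2) ^ 2) : ℝ) : ℂ) ∂μ := by
    congr 1; ext u; push_cast; ring
  rw [h2, integral_complex_ofReal, Complex.ofReal_re, integral_neg] at h1
  refine ⟨_, ?_, h1.congr_of_eventuallyEq (Filter.Eventually.of_forall (aux_real_eq μ))⟩
  have hpos : ∀ u : ℝ, 0 < 2 * s / (s ^ 2 + u ^ 2) ^ 2 := fun u => by positivity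
  have hint : Integrable (fun u : ℝ => 2 * s / (s ^ 2 + u ^ 2) ^ 2) μ := by
    refine Integrable.of_bound (Measurable.aestronglyMeasurable (by fun_prop))
      (2 * s / (s ^ 2) ^ 2) (Filter.Eventually.of_forall fun u => ?_)
    rw [Real.norm_of_nonneg (hpos u).le]
    have : s ^ 2 ≤ s ^ 2 + u ^ 2 := by nlinarith [sq_nonneg u]
    gcongr
  rw [neg_lt_zero, integral_pos_iff_support_of_nonneg (fun u => (hpos u).le) hint]
  have : Function.support (fun u : ℝ => 2 * s / (s ^ 2 + u ^ 2) ^ 2) = Set.univ := by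
    ext u; simpa using (hpos u).ne'
  rw [this]; simp


/-- Let `μ` be a Borel probability measure on `[0,∞)`, `t > λ₁(μ)²`.
Let `w0` be the unique `s > 0` with `∫ 1/(s²+u²) dμ(u) = 1/t` and, for `ε > 0`,
let `w(ε)` be the unique `s ∈ (ε,∞)` with `h_μ(s) = (s−ε)/t`. Then there are `δ > 0`
and a real-analytic `W : (−δ,δ) → ℝ` with `W(0) = w0`, `W(ε) = w(ε)` for
`0 < ε < δ`, and `W′(0) > 0`. -/
theorem stmt_5 (μ : Measure ℝ) [IsProbabilityMeasure μ] (hsupp : μ (Set.Iio 0) = 0)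
    (t : ℝ) (ht : 0 < t)
    (h : ℝ → ℝ) (hh : ∀ s : ℝ, h s = ∫ u, s / (s ^ 2 + u ^ 2) ∂μ)
    (lamSq : ℝ)
    (hlam : lamSq = ((∫⁻ u, (ENNReal.ofReal (u ^ 2))⁻¹ ∂μ)⁻¹).toReal)
    (hts : lamSq < t)
    (w0 : ℝ) (hw0 : 0 < w0 ∧ (∫ u, (w0 ^ 2 + u ^ 2)⁻¹ ∂μ) = 1 / t)
    (hw0u : ∀ s : ℝ, 0 < s → (∫ u, (s ^ 2 + u ^ 2)⁻¹ ∂μ) = 1 / t → s = w0)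
    (w : ℝ → ℝ)
    (hw : ∀ ε : ℝ, 0 < ε → ε < w ε ∧ h (w ε) = (w ε - ε) / t)
    (hwu : ∀ ε : ℝ, 0 < ε → ∀ s : ℝ, ε < s → h s = (s - ε) / t → s = w ε) :
    ∃ δ : ℝ, 0 < δ ∧ ∃ W : ℝ → ℝ,
      AnalyticOnNhd ℝ W (Set.Ioo (-δ) δ) ∧
      W 0 = w0 ∧ (∀ ε : ℝ, 0 < ε → ε < δ → W ε = w ε) ∧ 0 < deriv W 0 := by
  obtain ⟨hw0p, hw0e⟩ := hw0
  set g : ℝ → ℝ := fun s => ∫ u : ℝ, (s ^ 2 + u ^ 2)⁻¹ ∂μ with hg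
  have hhg : ∀ s, h s = s * g s := by
    intro s
    rw [hh, hg, ← integral_const_mul]
    rfl
  set F : ℝ → ℝ := fun s => s * (1 - t * g s) with hF
  have hg0 : g w0 = 1 / t := hw0e
  have hF0 : F w0 = 0 := by simp only [hF, hg0]; field_simp; ring
  have hFa : AnalyticAt ℝ F w0 :=
    analyticAt_id.mul (analyticAt_const.sub (analyticAt_const.mul (aux_analytic μ w0 hw0p)))
  obtain ⟨d, hd, hgd⟩ := aux_real_deriv μ w0 hw0p
  have hFd : HasDerivAt F (w0 * (-(t * d))) w0 := by
    have h1 := (hasDerivAt_id w0).mul ((hgd.const_mul t).const_sub 1)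
    refine h1.congr_deriv ?_
    change 1 * (1 - t * g w0) + w0 * (-(t * d)) = _
    rw [hg0]; field_simp; ring
  have hpos : 0 < deriv F w0 := by
    rw [hFd.deriv]
    have : 0 < t * (-d) := mul_pos ht (neg_pos.2 hd)
    exact mul_pos hw0p (by linarith)
  set W : ℝ → ℝ := hFa.hasStrictDerivAt.localInverse _ _ _ hpos.ne' with hW
  have hWa : AnalyticAt ℝ W 0 := by
    have := hFa.analyticAt_localInverse hpos.ne'
    rwa [hF0] at this
  have hW0 : W 0 = w0 := by
    have : W (F w0) = w0 := HasStrictFDerivAt.localInverse_apply_image ..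
    rwa [hF0] at this
  have hWd : HasStrictDerivAt W (deriv F w0)⁻¹ 0 := by
    have := hFa.hasStrictDerivAt.to_localInverse hpos.ne'
    rwa [hF0] at this
  have hWr : ∀ᶠ x in nhds (0 : ℝ), F (W x) = x := by
    have := hFa.hasStrictDerivAt.eventually_right_inverse hpos.ne'
    rwa [hF0] at this
  have hWlt : ∀ᶠ x in nhds (0 : ℝ), x < W x :=
    continuousAt_id.eventually_lt hWa.continuousAt (by simpa [hW0] using hw0p)
  obtain ⟨δ, hδ, hball⟩ := Metric.eventually_nhds_iff_ball.1
    (hWa.eventually_analyticAt.and (hWr.and hWlt))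
  have hmem : ∀ x ∈ Set.Ioo (-δ) δ, x ∈ Metric.ball (0 : ℝ) δ := by
    intro x hx
    simpa [abs_lt] using hx
  refine ⟨δ, hδ, W, fun x hx => (hball x (hmem x hx)).1, hW0, ?_, ?_⟩
  · intro ε h0 h1
    obtain ⟨-, h2, h3⟩ := hball ε (hmem ε ⟨by linarith, h1⟩)
    refine hwu ε h0 _ h3 ?_
    rw [hhg, eq_div_iff ht.ne']
    simp only [hF] at h2
    linarith
  · rw [hWd.hasDerivAt.deriv]
    exact inv_pos.2 hpos
end

section
/- The function v_t : ℝ → [0,∞) is continuous; Ξ_t = { a+ib ∈ ℂ : |b| < v_t(a) }; and for every λ = a+ib ∈ Ξ_t there is a unique w > 0 with ∫_ℝ 1/((a−u)² + b² + w²) dμ(u) = 1/t, and this unique w equals √(v_t(a)² − b²). -/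
open MeasureTheory

open Filter Topology

theorem aux_int (μ : Measure ℝ) [IsProbabilityMeasure μ] (a s : ℝ) (hs : 0 < s) :
    Integrable (fun u => ((a - u) ^ 2 + s)⁻¹) μ := by
  refine Integrable.of_bound (C := s⁻¹) (by fun_prop) (ae_of_all _ fun u => ?_)
  have h : 0 < (a - u) ^ 2 + s := by positivity
  rw [Real.norm_of_nonneg (by positivity)]
  exact inv_anti₀ hs (by nlinarith [sq_nonneg (a - u)])

theorem aux_strict (μ : Measure ℝ) [IsProbabilityMeasure μ] (a s s' : ℝ) (hs : 0 < s)
    (h : s < s') :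
    ∫ u, ((a - u) ^ 2 + s')⁻¹ ∂μ < ∫ u, ((a - u) ^ 2 + s)⁻¹ ∂μ := by
  have hlt : ∀ u : ℝ, ((a - u) ^ 2 + s')⁻¹ < ((a - u) ^ 2 + s)⁻¹ := fun u =>
    inv_strictAnti₀ (by positivity) (by linarith)
  have i1 := aux_int μ a s hs
  have i2 := aux_int μ a s' (hs.trans h)
  rw [← sub_pos, ← integral_sub i1 i2]
  rw [integral_pos_iff_support_of_nonneg (fun u => (sub_pos.2 (hlt u)).le) (i1.sub i2)]
  have : Function.support (fun u : ℝ => ((a - u) ^ 2 + s)⁻¹ - ((a - u) ^ 2 + s')⁻¹)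
      = Set.univ := by
    ext u
    simpa using (sub_pos.2 (hlt u)).ne'
  rw [this]
  simp

theorem aux_cont (μ : Measure ℝ) [IsProbabilityMeasure μ] (a s : ℝ) (hs : 0 < s) :
    ContinuousAt (fun p : ℝ × ℝ => ∫ u, ((p.1 - u) ^ 2 + p.2)⁻¹ ∂μ) (a, s) := by
  have hev : ∀ᶠ p : ℝ × ℝ in 𝓝 (a, s), s / 2 < p.2 :=
    continuous_snd.continuousAt.eventually (lt_mem_nhds (by simpa using hs))
  refine continuousAt_of_dominated (bound := fun _ => (s / 2)⁻¹) ?_ ?_ ?_ ?_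
  · exact Eventually.of_forall fun p => by fun_prop
  · filter_upwards [hev] with p hp
    refine ae_of_all _ fun u => ?_
    have h0 : 0 < p.2 := by linarith
    rw [Real.norm_of_nonneg (by positivity)]
    exact inv_anti₀ (by positivity) (by nlinarith [sq_nonneg (p.1 - u)])
  · exact integrable_const _
  · refine ae_of_all _ fun u => ContinuousAt.inv₀ (by fun_prop) ?_
    have : 0 < (a - u) ^ 2 + s := by positivity
    exact this.ne'

theorem aux_cont_y (μ : Measure ℝ) [IsProbabilityMeasure μ] (a y : ℝ) (hy : 0 < y) :
    ContinuousAt (fun y : ℝ => ∫ u, ((a - u) ^ 2 + y ^ 2)⁻¹ ∂μ) y :=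
  ContinuousAt.comp (f := fun y : ℝ => (a, y ^ 2)) (aux_cont μ a (y ^ 2) (by positivity))
    (by fun_prop)

theorem aux_cont_a (μ : Measure ℝ) [IsProbabilityMeasure μ] (a y : ℝ) (hy : 0 < y) :
    ContinuousAt (fun a : ℝ => ∫ u, ((a - u) ^ 2 + y ^ 2)⁻¹ ∂μ) a :=
  ContinuousAt.comp (f := fun a : ℝ => (a, y ^ 2)) (aux_cont μ a (y ^ 2) (by positivity))
    (by fun_prop)

theorem aux_ofReal (μ : Measure ℝ) [IsProbabilityMeasure μ] (a s : ℝ) (hs : 0 < s) :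
    ∫⁻ u, (ENNReal.ofReal ((a - u) ^ 2 + s))⁻¹ ∂μ
      = ENNReal.ofReal (∫ u, ((a - u) ^ 2 + s)⁻¹ ∂μ) := by
  rw [ofReal_integral_eq_lintegral_ofReal (aux_int μ a s hs)
    (ae_of_all _ fun u => by positivity)]
  refine lintegral_congr fun u => ?_
  rw [ENNReal.ofReal_inv_of_pos (by positivity)]

theorem aux_fatou (μ : Measure ℝ) [IsProbabilityMeasure μ] (a c : ℝ)
    (h : ∀ y : ℝ, 0 < y → ∫ u, ((a - u) ^ 2 + y ^ 2)⁻¹ ∂μ ≤ c) :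
    ∫⁻ u, (ENNReal.ofReal ((a - u) ^ 2 + 0 ^ 2))⁻¹ ∂μ ≤ ENNReal.ofReal c := by
  have hlim : Tendsto (fun n : ℕ => (1 / ((n : ℝ) + 1))) atTop (𝓝 0) :=
    tendsto_one_div_add_atTop_nhds_zero_nat
  have hpt : ∀ u : ℝ, Tendsto
      (fun n : ℕ => (ENNReal.ofReal ((a - u) ^ 2 + (1 / ((n : ℝ) + 1)) ^ 2))⁻¹) atTop
      (𝓝 (ENNReal.ofReal ((a - u) ^ 2 + 0 ^ 2))⁻¹) := fun u =>
    (ENNReal.tendsto_ofReal ((hlim.pow 2).const_add _)).inv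
  have hT := lintegral_tendsto_of_tendsto_of_monotone (μ := μ)
    (f := fun (n : ℕ) u => (ENNReal.ofReal ((a - u) ^ 2 + (1 / ((n : ℝ) + 1)) ^ 2))⁻¹)
    (F := fun u => (ENNReal.ofReal ((a - u) ^ 2 + 0 ^ 2))⁻¹)
    (fun n => by fun_prop) (ae_of_all _ fun u m n hmn => by
      have : (1 / ((n : ℝ) + 1)) ≤ 1 / ((m : ℝ) + 1) := by gcongr
      dsimp only
      gcongr) (ae_of_all _ hpt)
  refine le_of_tendsto hT (Eventually.of_forall fun n => ?_)
  rw [aux_ofReal μ a _ (by positivity)]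
  exact ENNReal.ofReal_le_ofReal (h _ (by positivity))

/-- Let `μ` be a compactly supported Borel probability measure on `ℝ`,
`t > 0`, `v_t(a) = inf{y > 0 : ∫ 1/((a−u)²+y²) dμ(u) ≤ 1/t}` and
`Ξ_t = {a+ib : ∫ 1/((a−u)²+b²) dμ(u) > 1/t}` (integral in `[0,∞]`). Then `v_t` is
continuous, `Ξ_t = {a+ib : |b| < v_t(a)}`, and for every `λ = a+ib ∈ Ξ_t` there is a
unique `w > 0` with `∫ 1/((a−u)²+b²+w²) dμ(u) = 1/t`, namely `w = √(v_t(a)² − b²)`. -/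
theorem stmt_8 (μ : Measure ℝ) [IsProbabilityMeasure μ]
    (hK : ∃ R : ℝ, μ {x : ℝ | R < |x|} = 0)
    (t : ℝ) (ht : 0 < t)
    (v : ℝ → ℝ)
    (hv : ∀ a : ℝ, v a = sInf {y : ℝ | 0 < y ∧
      (∫ u, ((a - u) ^ 2 + y ^ 2)⁻¹ ∂μ) ≤ 1 / t})
    (Ξ : Set ℂ)
    (hΞ : Ξ = {z : ℂ | ENNReal.ofReal (1 / t)
      < ∫⁻ u, (ENNReal.ofReal ((z.re - u) ^ 2 + z.im ^ 2))⁻¹ ∂μ}) :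
    Continuous v ∧
    Ξ = {z : ℂ | |z.im| < v z.re} ∧
    (∀ z ∈ Ξ,
      (0 < Real.sqrt (v z.re ^ 2 - z.im ^ 2) ∧
        (∫ u, ((z.re - u) ^ 2 + z.im ^ 2 + Real.sqrt (v z.re ^ 2 - z.im ^ 2) ^ 2)⁻¹ ∂μ)
          = 1 / t) ∧
      (∀ w : ℝ, 0 < w → (∫ u, ((z.re - u) ^ 2 + z.im ^ 2 + w ^ 2)⁻¹ ∂μ) = 1 / t →
        w = Real.sqrt (v z.re ^ 2 - z.im ^ 2))) := by
  have hbd : ∀ a, BddBelow {y : ℝ | 0 < y ∧ (∫ u, ((a - u) ^ 2 + y ^ 2)⁻¹ ∂μ) ≤ 1 / t} :=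
    fun a => ⟨0, fun y hy => hy.1.le⟩
  have hne : ∀ a, {y : ℝ | 0 < y ∧ (∫ u, ((a - u) ^ 2 + y ^ 2)⁻¹ ∂μ) ≤ 1 / t}.Nonempty := by
    intro a
    refine ⟨Real.sqrt t, Real.sqrt_pos.2 ht, ?_⟩
    rw [Real.sq_sqrt ht.le]
    have := integral_mono (μ := μ) (aux_int μ a t ht) (integrable_const t⁻¹) (fun u =>
      inv_anti₀ ht (by nlinarith [sq_nonneg (a - u)]))
    simpa using this
  have hmono : ∀ a y y' : ℝ, 0 < y → y < y' →
      ∫ u, ((a - u) ^ 2 + y' ^ 2)⁻¹ ∂μ < ∫ u, ((a - u) ^ 2 + y ^ 2)⁻¹ ∂μ := fun a y y' h h' =>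
    aux_strict μ a _ _ (by positivity) (by nlinarith)
  have hv0 : ∀ a, 0 ≤ v a := fun a => by
    rw [hv]; exact le_csInf (hne a) fun y hy => hy.1.le
  have h1 : ∀ a y, 0 < y → (∫ u, ((a - u) ^ 2 + y ^ 2)⁻¹ ∂μ) ≤ 1 / t → v a ≤ y :=
    fun a y hy h => by rw [hv]; exact csInf_le (hbd a) ⟨hy, h⟩
  have h1' : ∀ a y, 0 < y → 1 / t ≤ (∫ u, ((a - u) ^ 2 + y ^ 2)⁻¹ ∂μ) → y ≤ v a := by
    intro a y hy h
    rw [hv]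
    refine le_csInf (hne a) fun y' hy' => ?_
    by_contra! hlt
    have := hmono a y' y hy'.1 hlt
    linarith [hy'.2]
  have h2 : ∀ a y, 0 < y → (∫ u, ((a - u) ^ 2 + y ^ 2)⁻¹ ∂μ) < 1 / t → v a < y := by
    intro a y hy h
    have hc := ((aux_cont_y μ a y hy).eventually (gt_mem_nhds h)).and (lt_mem_nhds hy)
    obtain ⟨y', ⟨hy', hp⟩, hlt⟩ := ((hc.filter_mono nhdsWithin_le_nhds).and
      (self_mem_nhdsWithin : Set.Iio y ∈ 𝓝[<] y)).exists
    exact (h1 a y' hp hy'.le).trans_lt hlt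
  have h3 : ∀ a y, 0 < y → 1 / t < (∫ u, ((a - u) ^ 2 + y ^ 2)⁻¹ ∂μ) → y < v a := by
    intro a y hy h
    have hc := ((aux_cont_y μ a y hy).eventually (lt_mem_nhds h)).and (lt_mem_nhds hy)
    obtain ⟨y', ⟨hy', hp⟩, hlt⟩ := ((hc.filter_mono nhdsWithin_le_nhds).and
      (self_mem_nhdsWithin : Set.Ioi y ∈ 𝓝[>] y)).exists
    exact lt_of_lt_of_le hlt (h1' a y' hp hy'.le)
  have h4 : ∀ a y, 0 < y → y < v a → 1 / t < (∫ u, ((a - u) ^ 2 + y ^ 2)⁻¹ ∂μ) := by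
    intro a y hy h
    by_contra! hh
    linarith [h1 a y hy hh]
  have h5 : ∀ a y, 0 < y → v a < y → (∫ u, ((a - u) ^ 2 + y ^ 2)⁻¹ ∂μ) < 1 / t := by
    intro a y hy h
    by_contra! hh
    linarith [h1' a y hy hh]
  have hΞ' : Ξ = {z : ℂ | |z.im| < v z.re} := by
    rw [hΞ]
    ext z
    simp only [Set.mem_setOf_eq]
    rcases eq_or_ne z.im 0 with hb | hb
    · rw [hb, abs_zero]
      constructor
      · intro h
        by_contra! hle
        refine absurd (aux_fatou μ z.re (1 / t) fun y hy => ?_) (not_le.2 h)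
        by_contra! hh
        linarith [h3 z.re y hy hh]
      · intro h
        have hy : 0 < v z.re / 2 := by linarith
        have h6 := h4 z.re (v z.re / 2) hy (by linarith)
        have h7 := (ENNReal.ofReal_lt_ofReal_iff (lt_trans (by positivity) h6)).2 h6
        rw [← aux_ofReal μ z.re _ (by positivity)] at h7
        refine h7.trans_le (lintegral_mono fun u => ?_)
        dsimp only
        gcongr
    · have hb' : 0 < |z.im| := abs_pos.2 hb
      rw [aux_ofReal μ z.re _ (by positivity), ← sq_abs z.im,
        ENNReal.ofReal_lt_ofReal_iff_of_nonneg (by positivity)]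
      exact ⟨h3 _ _ hb', h4 _ _ hb'⟩
  refine ⟨?_, hΞ', ?_⟩
  · rw [continuous_iff_continuousAt]
    intro a
    refine tendsto_order.2 ⟨fun c hc => ?_, fun c hc => ?_⟩
    · rcases lt_or_ge c 0 with h0 | h0
      · exact Eventually.of_forall fun a' => h0.trans_le (hv0 a')
      · obtain ⟨y, hy1, hy2⟩ := exists_between hc
        have hy : 0 < y := h0.trans_lt hy1
        filter_upwards [(aux_cont_a μ a y hy).eventually (lt_mem_nhds (h4 a y hy hy2))] with a' h
        exact hy1.trans (h3 a' y hy h)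
    · obtain ⟨y, hy1, hy2⟩ := exists_between hc
      have hy : 0 < y := (hv0 a).trans_lt hy1
      filter_upwards [(aux_cont_a μ a y hy).eventually (gt_mem_nhds (h5 a y hy hy1))] with a' h
      exact (h2 a' y hy h).trans hy2
  · intro z hz
    rw [hΞ'] at hz
    have hz' : |z.im| < v z.re := hz
    have hpos : 0 < v z.re := (abs_nonneg _).trans_lt hz'
    have hd : 0 < v z.re ^ 2 - z.im ^ 2 := by
      rw [← sq_abs z.im]; nlinarith [abs_nonneg z.im]
    refine ⟨⟨Real.sqrt_pos.2 hd, ?_⟩, ?_⟩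
    · rw [Real.sq_sqrt hd.le]
      have : ∀ u : ℝ, (z.re - u) ^ 2 + z.im ^ 2 + (v z.re ^ 2 - z.im ^ 2)
          = (z.re - u) ^ 2 + v z.re ^ 2 := fun u => by ring
      simp only [this]
      refine le_antisymm ?_ ?_
      · by_contra! hh
        exact lt_irrefl _ (h3 _ _ hpos hh)
      · by_contra! hh
        exact lt_irrefl _ (h2 _ _ hpos hh)
    · intro w hw h
      have hs : 0 < z.im ^ 2 + w ^ 2 := by positivity
      have hy := Real.sqrt_pos.2 hs
      simp only [add_assoc] at h
      rw [← Real.sq_sqrt hs.le] at h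
      have hveq := le_antisymm (h1 _ _ hy h.le) (h1' _ _ hy h.ge)
      rw [hveq, Real.sq_sqrt hs.le, add_sub_cancel_left, Real.sqrt_sq hw.le]
end
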